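/- arXiv:2108.05790 — 5 statements merged into one kernel-verified Lean document; each statement's English description precedes it below -/
import Mathlib

section
/- The function h_EP is harmonic on the open set EP = {(x₁, x₂) ∈ ℝ² : x₂ < x₁²}. -/
open Real MeasureTheory

/-- The exterior of the parabola `x₂ = x₁²` in `ℝ² ≃ ℂ`. -/
def EP : Set ℂ := {z : ℂ | z.im < z.re ^ 2}

/-- The harmonic profile of the exterior of the parabola,
`h_EP(x₁,x₂) = √(2(√(x₁² + (1/4 − x₂)²) + 1/4 − x₂)) − 1`. -/
noncomputable def hEP (z : ℂ) : ℝ :=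
  Real.sqrt (2 * (Real.sqrt (z.re ^ 2 + (1 / 4 - z.im) ^ 2) + 1 / 4 - z.im)) - 1

/-- A real-valued function on an open subset of `ℝ² ≃ ℂ` is harmonic if it is twice
continuously differentiable there and `∂²u/∂x₁² + ∂²u/∂x₂² = 0`. -/
def IsHarmonicOn (u : ℂ → ℝ) (U : Set ℂ) : Prop :=
  ContDiffOn ℝ 2 u U ∧
  ∀ z ∈ U,
    deriv (deriv (fun x : ℝ => u ((x : ℂ) + (z.im : ℂ) * Complex.I))) z.re +
    deriv (deriv (fun y : ℝ => u ((z.re : ℂ) + (y : ℂ) * Complex.I))) z.im = 0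

theorem hasDerivAt_re_comp_line {F : ℂ → ℂ} {a c F' : ℂ} {t : ℝ}
    (hF : HasDerivAt F F' (a + t * c)) :
    HasDerivAt (fun s : ℝ => (F (a + s * c)).re) (F' * c).re t := by
  have hline : HasDerivAt (fun w : ℂ => a + w * c) c (t : ℂ) := by
    simpa using ((hasDerivAt_id (t : ℂ)).mul_const c).const_add a
  exact (HasDerivAt.comp (t : ℂ) hF hline).real_of_complex

theorem deriv_deriv_re_comp_line {F : ℂ → ℂ} {U : Set ℂ} (hU : IsOpen U)
    (hF : DifferentiableOn ℂ F U) {a c : ℂ} {t : ℝ} (ht : a + t * c ∈ U) :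
    deriv (deriv (fun s : ℝ => (F (a + s * c)).re)) t =
      (deriv (deriv F) (a + t * c) * c * c).re := by
  have hd : deriv (fun s : ℝ => (F (a + s * c)).re) =ᶠ[nhds t]
      fun s : ℝ => (deriv F (a + s * c) * c).re := by
    have hcont : Continuous fun s : ℝ => a + s * c := by fun_prop
    filter_upwards [(hU.preimage hcont).mem_nhds ht] with s hs
    exact (hasDerivAt_re_comp_line (hF.differentiableAt (hU.mem_nhds hs)).hasDerivAt).deriv
  rw [hd.deriv_eq]
  have hF' := ((hF.deriv hU).differentiableAt (hU.mem_nhds ht)).hasDerivAt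
  exact (hasDerivAt_re_comp_line (F := fun w => deriv F w * c) (hF'.mul_const c)).deriv

/-- The real part of a holomorphic function is harmonic. -/
theorem isHarmonicOn_re {F : ℂ → ℂ} {U : Set ℂ} (hU : IsOpen U)
    (hF : DifferentiableOn ℂ F U) : IsHarmonicOn (fun z => (F z).re) U := by
  refine ⟨Complex.reCLM.contDiff.comp_contDiffOn ((hF.contDiffOn hU).restrict_scalars ℝ), ?_⟩
  intro z hz
  have hx : (z.im : ℂ) * Complex.I + (z.re : ℂ) * 1 = z := by
    rw [mul_one, add_comm, Complex.re_add_im]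
  have hy : (z.re : ℂ) + (z.im : ℂ) * Complex.I = z := Complex.re_add_im z
  have h₁ := deriv_deriv_re_comp_line hU hF (a := z.im * Complex.I) (c := 1) (t := z.re)
    (by rwa [hx])
  have h₂ := deriv_deriv_re_comp_line hU hF (a := z.re) (c := Complex.I) (t := z.im)
    (by rwa [hy])
  rw [hx] at h₁
  rw [hy] at h₂
  simp only [mul_one, add_comm ((z.im : ℂ) * Complex.I)] at h₁
  rw [h₁, h₂, mul_assoc, Complex.I_mul_I]
  simp

theorem isOpen_EP : IsOpen EP :=
  isOpen_lt Complex.continuous_im (Complex.continuous_re.pow 2)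

theorem mem_slitPlane_of_mem_EP {z : ℂ} (hz : z ∈ EP) :
    1 / 4 + Complex.I * z ∈ Complex.slitPlane := by
  have hz' : z.im < z.re ^ 2 := hz
  rw [Complex.mem_slitPlane_iff]
  by_cases h : z.re = 0
  · left
    norm_num [h] at hz' ⊢
    linarith
  · right
    simpa using h

theorem hEP_eq_re (z : ℂ) :
    hEP z = (2 * (1 / 4 + Complex.I * z) ^ (2⁻¹ : ℂ) - 1).re := by
  have hre : (1 / 4 + Complex.I * z).re = 1 / 4 - z.im := by
    norm_num [sub_eq_add_neg]
  have him : (1 / 4 + Complex.I * z).im = z.re := by simp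
  have hnorm : ‖1 / 4 + Complex.I * z‖ = √(z.re ^ 2 + (1 / 4 - z.im) ^ 2) := by
    rw [Complex.norm_eq_sqrt_sq_add_sq, hre, him, add_comm]
  have htwo (w : ℂ) : (2 * w - 1).re = 2 * w.re - 1 := by simp
  rw [htwo, Complex.cpow_inv_two_re, hnorm, hre, hEP]
  congr 1
  rw [← Real.sqrt_sq (zero_le_two (α := ℝ)), ← Real.sqrt_mul (by positivity),
    Real.sqrt_sq zero_le_two]
  congr 1
  ring

theorem stmt6 : IsHarmonicOn hEP EP := by
  rw [funext hEP_eq_re]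
  refine isHarmonicOn_re isOpen_EP fun z hz => ?_
  have hw : DifferentiableAt ℂ (fun z : ℂ => 1 / 4 + Complex.I * z) z := by fun_prop
  exact (((hw.cpow_const (mem_slitPlane_of_mem_EP hz)).const_mul 2).sub_const
    1).differentiableWithinAt
end

section
/- For every (x₁, x₂) ∈ EP, the complex number ζ = (1/4 − x₂) + i·x₁ does not lie on the closed negative real axis (−∞, 0], and h_EP(x₁, x₂) = 2·Re(√ζ) − 1, where √ζ denotes the principal branch of the complex square root. -/
open Real MeasureTheory

theorem stmt8 :
    ∀ z : ℂ, z ∈ EP →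
      (((1 / 4 - z.im : ℝ) : ℂ) + (z.re : ℂ) * Complex.I) ∉
          {w : ℂ | w.re ≤ 0 ∧ w.im = 0} ∧
      hEP z =
        2 * (((((1 / 4 - z.im : ℝ) : ℂ) + (z.re : ℂ) * Complex.I) ^ (1 / 2 : ℂ)).re) - 1 := by
  intro z hz
  have hz : z.im < z.re ^ 2 := hz
  constructor
  · rintro ⟨h_re, h_im⟩
    simp only [Complex.add_re, Complex.add_im, Complex.ofReal_re, Complex.ofReal_im,
      Complex.re_ofReal_mul, Complex.im_ofReal_mul, Complex.I_re, Complex.I_im] at h_re h_im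
    have h0 : z.re = 0 := by linarith
    rw [h0] at hz
    linarith
  · have h_re : (((1 / 4 - z.im : ℝ) : ℂ) + (z.re : ℂ) * Complex.I).re = 1 / 4 - z.im := by simp
    rw [one_div (2 : ℂ), Complex.cpow_inv_two_re, Complex.norm_add_mul_I, h_re, hEP,
      add_comm ((1 / 4 - z.im) ^ 2), add_sub_assoc]
    set r := √(z.re ^ 2 + (1 / 4 - z.im) ^ 2) + (1 / 4 - z.im)
    rw [show 2 * r = 2 ^ 2 * (r / 2) by ring, Real.sqrt_mul (by positivity),
      Real.sqrt_sq (by positivity)]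
end

section
/- Let V : (0, ∞) → ℝ be continuous and positive, assume s ↦ s·e^{−1/s}/V(s) is Lebesgue integrable on (0, 1), and assume I(R) = ∫₀^R s·e^{−1/s}/V(s) ds tends to +∞ as R → ∞. Set G(R) = 1/I(R) and F(R) = ∫_{R²}^∞ dt/(I(√t)² · V(√t)). Then for every R > 0, the integral defining F(R) is finite and 2·G(R) ≤ F(R) ≤ 2·e^{1/R}·G(R); in particular F(R)/G(R) → 2 as R → ∞, so F and G are comparable with constants independent of R ≥ 1. -/
open Real MeasureTheory Filter

/-- `I(R) = ∫₀^R s e^{-1/s} / V(s) ds`. -/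
noncomputable def Ifun (V : ℝ → ℝ) (R : ℝ) : ℝ :=
  ∫ s in Set.Ioo (0 : ℝ) R, s * Real.exp (-1 / s) / V s

/-- `G(R) = 1 / I(R)`. -/
noncomputable def Gfun (V : ℝ → ℝ) (R : ℝ) : ℝ := 1 / Ifun V R

/-- `F(R) = ∫_{R²}^∞ dt / (I(√t)² V(√t))`. -/
noncomputable def Ffun (V : ℝ → ℝ) (R : ℝ) : ℝ :=
  ∫ t in Set.Ioi (R ^ 2), 1 / ((Ifun V (Real.sqrt t)) ^ 2 * V (Real.sqrt t))

theorem continuousOn_integrand {V : ℝ → ℝ} (hVc : ContinuousOn V (Set.Ioi (0 : ℝ)))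
    (hVpos : ∀ s : ℝ, 0 < s → 0 < V s) :
    ContinuousOn (fun s : ℝ => s * Real.exp (-1 / s) / V s) (Set.Ioi 0) := by
  refine ContinuousOn.div (ContinuousOn.mul continuousOn_id ?_) hVc
    (fun s hs => (hVpos s hs).ne')
  exact (ContinuousOn.div continuousOn_const continuousOn_id
    (fun s hs => (Set.mem_Ioi.1 hs).ne')).rexp

theorem intervalIntegrable_integrand {V : ℝ → ℝ} (hVc : ContinuousOn V (Set.Ioi (0 : ℝ)))
    (hVpos : ∀ s : ℝ, 0 < s → 0 < V s)
    (hint : IntegrableOn (fun s : ℝ => s * Real.exp (-1 / s) / V s) (Set.Ioo 0 1))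
    {R : ℝ} (hR : 0 < R) :
    IntervalIntegrable (fun s : ℝ => s * Real.exp (-1 / s) / V s) volume 0 R := by
  rw [intervalIntegrable_iff_integrableOn_Ioc_of_le hR.le]
  have h2 : IntegrableOn (fun s : ℝ => s * Real.exp (-1 / s) / V s) (Set.Icc (1 / 2) R) := by
    refine ContinuousOn.integrableOn_Icc ((continuousOn_integrand hVc hVpos).mono ?_)
    intro x hx
    exact lt_of_lt_of_le (by norm_num) hx.1
  refine (hint.union h2).mono_set ?_
  intro x hx
  rcases lt_or_ge x 1 with h | h
  · exact Or.inl ⟨hx.1, h⟩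
  · exact Or.inr ⟨by linarith, hx.2⟩

theorem Ifun_eq_intervalIntegral (V : ℝ → ℝ) {R : ℝ} (hR : 0 ≤ R) :
    Ifun V R = ∫ s in (0 : ℝ)..R, s * Real.exp (-1 / s) / V s := by
  rw [intervalIntegral.integral_of_le hR, integral_Ioc_eq_integral_Ioo, Ifun]

theorem Ifun_pos {V : ℝ → ℝ} (hVc : ContinuousOn V (Set.Ioi (0 : ℝ)))
    (hVpos : ∀ s : ℝ, 0 < s → 0 < V s)
    (hint : IntegrableOn (fun s : ℝ => s * Real.exp (-1 / s) / V s) (Set.Ioo 0 1))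
    {R : ℝ} (hR : 0 < R) : 0 < Ifun V R := by
  rw [Ifun_eq_intervalIntegral V hR.le]
  refine intervalIntegral.intervalIntegral_pos_of_pos_on
    (intervalIntegrable_integrand hVc hVpos hint hR) (fun s hs => ?_) hR
  exact div_pos (mul_pos hs.1 (Real.exp_pos _)) (hVpos s hs.1)

theorem hasDerivAt_Ifun {V : ℝ → ℝ} (hVc : ContinuousOn V (Set.Ioi (0 : ℝ)))
    (hVpos : ∀ s : ℝ, 0 < s → 0 < V s)
    (hint : IntegrableOn (fun s : ℝ => s * Real.exp (-1 / s) / V s) (Set.Ioo 0 1))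
    {R : ℝ} (hR : 0 < R) : HasDerivAt (Ifun V) (R * Real.exp (-1 / R) / V R) R := by
  have hc := continuousOn_integrand hVc hVpos
  have h := intervalIntegral.integral_hasDerivAt_right
    (intervalIntegrable_integrand hVc hVpos hint hR)
    (hc.stronglyMeasurableAtFilter isOpen_Ioi R hR)
    (hc.continuousAt (Ioi_mem_nhds hR))
  refine h.congr_of_eventuallyEq ?_
  filter_upwards [Ioi_mem_nhds hR] with r hr
  exact Ifun_eq_intervalIntegral V (Set.mem_Ioi.1 hr).le

theorem hasDerivAt_neg_two_div_Ifun_sqrt {V : ℝ → ℝ} (hVc : ContinuousOn V (Set.Ioi (0 : ℝ)))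
    (hVpos : ∀ s : ℝ, 0 < s → 0 < V s)
    (hint : IntegrableOn (fun s : ℝ => s * Real.exp (-1 / s) / V s) (Set.Ioo 0 1))
    {t : ℝ} (ht : 0 < t) :
    HasDerivAt (fun t => -2 / Ifun V (Real.sqrt t))
      (Real.exp (-1 / Real.sqrt t) *
        (1 / ((Ifun V (Real.sqrt t)) ^ 2 * V (Real.sqrt t)))) t := by
  have hs := Real.sqrt_pos.2 ht
  have hI := (Ifun_pos hVc hVpos hint hs).ne'
  have hV := (hVpos _ hs).ne'
  have h1 := (hasDerivAt_Ifun hVc hVpos hint hs).comp t (Real.hasDerivAt_sqrt ht.ne')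
  have h2 := (hasDerivAt_const t (-2 : ℝ)).div h1 hI
  refine h2.congr_deriv ?_
  simp only [Function.comp_apply]
  field_simp
  ring

theorem Gfun_Ffun_bounds {V : ℝ → ℝ} (hVc : ContinuousOn V (Set.Ioi (0 : ℝ)))
    (hVpos : ∀ s : ℝ, 0 < s → 0 < V s)
    (hint : IntegrableOn (fun s : ℝ => s * Real.exp (-1 / s) / V s) (Set.Ioo 0 1))
    (htop : Tendsto (Ifun V) atTop atTop) {R : ℝ} (hR : 0 < R) :
    IntegrableOn (fun t : ℝ => 1 / ((Ifun V (Real.sqrt t)) ^ 2 * V (Real.sqrt t)))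
        (Set.Ioi (R ^ 2)) ∧
      2 * Gfun V R ≤ Ffun V R ∧
      Ffun V R ≤ 2 * Real.exp (1 / R) * Gfun V R := by
  set f : ℝ → ℝ := fun t => 1 / ((Ifun V (Real.sqrt t)) ^ 2 * V (Real.sqrt t)) with hf
  set k : ℝ → ℝ := fun t => Real.exp (-1 / Real.sqrt t) * f t with hk
  have hR2 : 0 < R ^ 2 := by positivity
  have hpos : ∀ t ∈ Set.Ioi (R ^ 2), 0 < t := fun t ht => hR2.trans ht
  have hf0 : ∀ t ∈ Set.Ioi (R ^ 2), 0 ≤ f t := fun t ht => by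
    have hs := Real.sqrt_pos.2 (hpos t ht)
    have := hVpos _ hs
    simp only [hf]
    positivity
  have hderiv : ∀ t ∈ Set.Ici (R ^ 2), HasDerivAt (fun t => -2 / Ifun V (Real.sqrt t)) (k t) t :=
    fun t ht => hasDerivAt_neg_two_div_Ifun_sqrt hVc hVpos hint (hR2.trans_le ht)
  have hk0 : ∀ t ∈ Set.Ioi (R ^ 2), 0 ≤ k t := fun t ht =>
    mul_nonneg (Real.exp_pos _).le (hf0 t ht)
  have hlim : Tendsto (fun t => -2 / Ifun V (Real.sqrt t)) atTop (nhds 0) :=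
    (htop.comp Real.tendsto_sqrt_atTop).const_div_atTop (-2)
  have hkint : IntegrableOn k (Set.Ioi (R ^ 2)) :=
    integrableOn_Ioi_deriv_of_nonneg' hderiv hk0 hlim
  have hkval : ∫ t in Set.Ioi (R ^ 2), k t = 2 * Gfun V R := by
    rw [integral_Ioi_of_hasDerivAt_of_nonneg' hderiv hk0 hlim, Real.sqrt_sq hR.le, Gfun]
    ring
  have hle : ∀ t ∈ Set.Ioi (R ^ 2), k t ≤ f t := fun t ht => by
    refine mul_le_of_le_one_left (hf0 t ht) (Real.exp_le_one_iff.2 ?_)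
    exact div_nonpos_of_nonpos_of_nonneg (by norm_num) (Real.sqrt_nonneg t)
  have hge : ∀ t ∈ Set.Ioi (R ^ 2), f t ≤ Real.exp (1 / R) * k t := fun t ht => by
    have hRs : R ≤ Real.sqrt t := Real.le_sqrt_of_sq_le (Set.mem_Ioi.1 ht).le
    have h1 : 1 / Real.sqrt t ≤ 1 / R := one_div_le_one_div_of_le hR hRs
    simp only [hk]
    rw [← mul_assoc, ← Real.exp_add]
    refine le_mul_of_one_le_left (hf0 t ht) (Real.one_le_exp ?_)
    rw [neg_div]
    linarith
  have hsq : ContinuousOn Real.sqrt (Set.Ioi (R ^ 2)) := Real.continuous_sqrt.continuousOn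
  have hmaps : Set.MapsTo Real.sqrt (Set.Ioi (R ^ 2)) (Set.Ioi 0) :=
    fun t ht => Real.sqrt_pos.2 (hpos t ht)
  have hIc : ContinuousOn (Ifun V) (Set.Ioi 0) := fun s hs =>
    (hasDerivAt_Ifun hVc hVpos hint hs).continuousAt.continuousWithinAt
  have hfc : ContinuousOn f (Set.Ioi (R ^ 2)) := by
    refine continuousOn_const.div
      (((hIc.comp hsq hmaps).pow 2).mul (hVc.comp hsq hmaps)) (fun t ht => ?_)
    have hs := Real.sqrt_pos.2 (hpos t ht)
    exact (mul_pos (pow_pos (Ifun_pos hVc hVpos hint hs) 2) (hVpos _ hs)).ne'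
  have hek : IntegrableOn (fun t => Real.exp (1 / R) * k t) (Set.Ioi (R ^ 2)) :=
    Integrable.const_mul hkint _
  have hfint : IntegrableOn f (Set.Ioi (R ^ 2)) := by
    refine Integrable.mono' hek (hfc.aestronglyMeasurable measurableSet_Ioi) ?_
    filter_upwards [ae_restrict_mem measurableSet_Ioi] with t ht
    rw [Real.norm_of_nonneg (hf0 t ht)]
    exact hge t ht
  refine ⟨hfint, ?_, ?_⟩
  · rw [← hkval]
    exact setIntegral_mono_on hkint hfint measurableSet_Ioi hle
  · calc Ffun V R ≤ ∫ t in Set.Ioi (R ^ 2), Real.exp (1 / R) * k t :=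
          setIntegral_mono_on hfint hek measurableSet_Ioi hge
      _ = 2 * Real.exp (1 / R) * Gfun V R := by
          rw [integral_const_mul, hkval]
          ring

theorem stmt10 (V : ℝ → ℝ) (hVc : ContinuousOn V (Set.Ioi (0 : ℝ)))
    (hVpos : ∀ s : ℝ, 0 < s → 0 < V s)
    (hint : IntegrableOn (fun s : ℝ => s * Real.exp (-1 / s) / V s) (Set.Ioo 0 1))
    (htop : Tendsto (Ifun V) atTop atTop) :
    (∀ R : ℝ, 0 < R →
      IntegrableOn (fun t : ℝ => 1 / ((Ifun V (Real.sqrt t)) ^ 2 * V (Real.sqrt t)))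
        (Set.Ioi (R ^ 2)) ∧
      2 * Gfun V R ≤ Ffun V R ∧
      Ffun V R ≤ 2 * Real.exp (1 / R) * Gfun V R) ∧
    Tendsto (fun R => Ffun V R / Gfun V R) atTop (nhds 2) ∧
    ∃ c C : ℝ, 0 < c ∧ c ≤ C ∧
      ∀ R : ℝ, 1 ≤ R → c * Gfun V R ≤ Ffun V R ∧ Ffun V R ≤ C * Gfun V R := by
  have hmain := fun (R : ℝ) (hR : 0 < R) => Gfun_Ffun_bounds hVc hVpos hint htop hR
  have hG : ∀ R : ℝ, 0 < R → 0 < Gfun V R := fun R hR =>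
    one_div_pos.2 (Ifun_pos hVc hVpos hint hR)
  refine ⟨hmain, ?_, 2, 2 * Real.exp 1, by norm_num, ?_, fun R hR => ?_⟩
  · have hlim : Tendsto (fun R : ℝ => 2 * Real.exp (1 / R)) atTop (nhds 2) := by
      have h := (Real.continuous_exp.tendsto 0).comp
        (tendsto_const_nhds (x := (1 : ℝ)).div_atTop (tendsto_id (α := ℝ)))
      simpa using h.const_mul 2
    refine tendsto_of_tendsto_of_tendsto_of_le_of_le' tendsto_const_nhds hlim ?_ ?_
    · filter_upwards [eventually_gt_atTop 0] with R hR
      exact (le_div_iff₀ (hG R hR)).2 (hmain R hR).2.1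
    · filter_upwards [eventually_gt_atTop 0] with R hR
      exact (div_le_iff₀ (hG R hR)).2 (hmain R hR).2.2
  · linarith [Real.one_le_exp (zero_le_one (α := ℝ))]
  · have hR0 : 0 < R := by linarith
    obtain ⟨-, h1, h2⟩ := hmain R hR0
    refine ⟨h1, h2.trans (mul_le_mul_of_nonneg_right ?_ (hG R hR0).le)⟩
    have : Real.exp (1 / R) ≤ Real.exp 1 :=
      Real.exp_le_exp.2 ((div_le_one hR0).2 hR)
    linarith
end

section
/- There exist constants 0 < c ≤ C < ∞ such that for every r ≥ 1, c·r³ ≤ ∫_{EP ∩ B(0,r)} h_EP(x)² dλ(x) ≤ C·r³, where B(0,r) is the open Euclidean ball of radius r about the origin and λ is two-dimensional Lebesgue measure. -/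
open Real MeasureTheory

theorem continuous_hEP : Continuous hEP := by
  unfold hEP
  fun_prop

theorem integrableOn_hEP_sq_ball (w : ℂ) (r : ℝ) :
    IntegrableOn (fun z => (hEP z) ^ 2) (Metric.ball w r) :=
  ((continuous_hEP.pow 2).continuousOn.integrableOn_compact
    (isCompact_closedBall w r)).mono_set Metric.ball_subset_closedBall

theorem volume_real_ball (w : ℂ) {r : ℝ} (hr : 0 ≤ r) :
    volume.real (Metric.ball w r) = r ^ 2 * π := by
  simp [Measure.real, Complex.volume_ball, ENNReal.toReal_mul, ENNReal.toReal_pow,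
    ENNReal.toReal_ofReal hr]

theorem hEP_sq_le {z : ℂ} {r : ℝ} (hr : 1 ≤ r) (hz : ‖z‖ ≤ r) : (hEP z) ^ 2 ≤ 8 * r := by
  have hx := abs_le.mp ((Complex.abs_re_le_norm z).trans hz)
  have hy := abs_le.mp ((Complex.abs_im_le_norm z).trans hz)
  have hroot : √(z.re ^ 2 + (1 / 4 - z.im) ^ 2) ≤ r + (r + 1 / 4) := by
    refine Real.sqrt_le_iff.mpr ⟨by linarith, ?_⟩
    nlinarith [sq_le_sq' hx.1 hx.2,
      sq_le_sq' (show -(r + 1 / 4) ≤ 1 / 4 - z.im by linarith) (by linarith)]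
  unfold hEP
  set s := √(2 * (√(z.re ^ 2 + (1 / 4 - z.im) ^ 2) + 1 / 4 - z.im))
  have hs : s ^ 2 ≤ 6 * r + 1 := by
    rw [← Real.le_sqrt (Real.sqrt_nonneg _) (by linarith)]
    exact Real.sqrt_le_sqrt (by linarith)
  nlinarith [Real.sqrt_nonneg (2 * (√(z.re ^ 2 + (1 / 4 - z.im) ^ 2) + 1 / 4 - z.im))]

theorem le_hEP_sq {z : ℂ} {r : ℝ} (hr : 1 ≤ r) (hz : z.im ≤ -(r / 4)) :
    r / 9 ≤ (hEP z) ^ 2 := by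
  have hroot : 1 / 4 - z.im ≤ √(z.re ^ 2 + (1 / 4 - z.im) ^ 2) :=
    Real.le_sqrt_of_sq_le (by nlinarith [sq_nonneg z.re])
  have hr2 : √r ^ 2 = r := Real.sq_sqrt (by linarith)
  have hr1 : 1 ≤ √r := Real.one_le_sqrt.mpr hr
  have hs : 1 + √r / 3 ≤ √(2 * (√(z.re ^ 2 + (1 / 4 - z.im) ^ 2) + 1 / 4 - z.im)) :=
    Real.le_sqrt_of_sq_le (by nlinarith)
  unfold hEP
  nlinarith

theorem ball_subset_EP_inter_ball {r : ℝ} (hr : 0 ≤ r) :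
    Metric.ball (⟨0, -(r / 2)⟩ : ℂ) (r / 4) ⊆
      (EP ∩ Metric.ball (0 : ℂ) r) ∩ {z | z.im ≤ -(r / 4)} := by
  intro z hz
  rw [Metric.mem_ball, dist_eq_norm] at hz
  have him := abs_lt.mp ((Complex.abs_im_le_norm _).trans_lt hz)
  simp only [Complex.sub_im] at him
  have hc : ‖(⟨0, -(r / 2)⟩ : ℂ)‖ ≤ r / 2 := by
    refine (Complex.norm_le_abs_re_add_abs_im _).trans ?_
    simp [abs_of_nonneg (div_nonneg hr zero_le_two)]
  refine ⟨⟨?_, ?_⟩, ?_⟩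
  · change z.im < z.re ^ 2
    nlinarith [sq_nonneg z.re]
  · rw [mem_ball_zero_iff]
    linarith [norm_le_norm_sub_add z (⟨0, -(r / 2)⟩ : ℂ)]
  · change z.im ≤ -(r / 4)
    linarith

theorem stmt15 :
    ∃ c C : ℝ, 0 < c ∧ c ≤ C ∧
      ∀ r : ℝ, 1 ≤ r →
        c * r ^ 3 ≤ (∫ z in EP ∩ Metric.ball (0 : ℂ) r, (hEP z) ^ 2) ∧
        (∫ z in EP ∩ Metric.ball (0 : ℂ) r, (hEP z) ^ 2) ≤ C * r ^ 3 := by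
  refine ⟨π / 144, 8 * π, by positivity, by linarith [Real.pi_pos], fun r hr => ⟨?_, ?_⟩⟩
  · have hsub := ball_subset_EP_inter_ball (r := r) (by linarith)
    calc π / 144 * r ^ 3
        = r / 9 * volume.real (Metric.ball (⟨0, -(r / 2)⟩ : ℂ) (r / 4)) := by
          rw [volume_real_ball _ (by linarith)]; ring
      _ ≤ ∫ z in Metric.ball (⟨0, -(r / 2)⟩ : ℂ) (r / 4), (hEP z) ^ 2 :=
          setIntegral_ge_of_const_le_real measurableSet_ball measure_ball_lt_top.ne
            (fun z hz => le_hEP_sq hr (hsub hz).2) (integrableOn_hEP_sq_ball _ _)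
      _ ≤ ∫ z in EP ∩ Metric.ball (0 : ℂ) r, (hEP z) ^ 2 :=
          setIntegral_mono_set ((integrableOn_hEP_sq_ball 0 r).mono_set Set.inter_subset_right)
            (.of_forall fun z => sq_nonneg (hEP z))
            (hsub.trans Set.inter_subset_left).eventuallyLE
  · calc ∫ z in EP ∩ Metric.ball (0 : ℂ) r, (hEP z) ^ 2
        ≤ ∫ z in Metric.ball (0 : ℂ) r, (hEP z) ^ 2 :=
          setIntegral_mono_set (integrableOn_hEP_sq_ball 0 r)
            (.of_forall fun z => sq_nonneg (hEP z)) Set.inter_subset_right.eventuallyLE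
      _ ≤ ∫ _ in Metric.ball (0 : ℂ) r, 8 * r :=
          setIntegral_mono_on (integrableOn_hEP_sq_ball 0 r)
            (integrableOn_const measure_ball_lt_top.ne) measurableSet_ball
            fun z hz => hEP_sq_le hr (mem_ball_zero_iff.mp hz).le
      _ = 8 * π * r ^ 3 := by
          rw [setIntegral_const, volume_real_ball _ (by linarith), smul_eq_mul]; ring
end

section
/- For every x = (x₁, x₂) ∈ ℝ² with x₂ ≤ 0 and ‖x‖ ≥ 1 (where ‖x‖ is the Euclidean norm), one has x ∈ EP and √(2‖x‖) − 1 ≤ h_EP(x) ≤ √(5‖x‖). -/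
open Real MeasureTheory

theorem stmt16 :
    ∀ z : ℂ, z.im ≤ 0 → 1 ≤ ‖z‖ →
      z ∈ EP ∧
      Real.sqrt (2 * ‖z‖) - 1 ≤ hEP z ∧
      hEP z ≤ Real.sqrt (5 * ‖z‖) := by
  intro z hy hn
  have hsq : ‖z‖ ^ 2 = z.re ^ 2 + z.im ^ 2 := by
    rw [Complex.sq_norm, Complex.normSq_apply]; ring
  have him : -z.im ≤ ‖z‖ := (neg_le_abs _).trans (Complex.abs_im_le_norm z)
  have hlower : ‖z‖ ≤ √(z.re ^ 2 + (1 / 4 - z.im) ^ 2) :=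
    Real.le_sqrt_of_sq_le (by nlinarith)
  have hupper : √(z.re ^ 2 + (1 / 4 - z.im) ^ 2) ≤ ‖z‖ + 1 / 4 :=
    Real.sqrt_le_iff.mpr ⟨by linarith, by nlinarith⟩
  refine ⟨?_, ?_, ?_⟩
  · change z.im < z.re ^ 2
    rcases hy.lt_or_eq with h | h
    · exact h.trans_le (sq_nonneg _)
    · rw [h] at hsq ⊢
      nlinarith
  · exact sub_le_sub_right (Real.sqrt_le_sqrt (by linarith)) 1
  · exact (sub_le_self _ zero_le_one).trans (Real.sqrt_le_sqrt (by linarith))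
end
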